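/- arXiv:2501.06620 — 2 statements merged into one kernel-verified Lean document; each statement's English description precedes it below -/
import Mathlib

section
/- Let N ≥ 1 be a natural number and K an odd natural number. Let x_1,…,x_N ∈ [−1,1] and x_i' ∈ [−1,1], and let D' be the dataset obtained from D = (x_1,…,x_N) by replacing the i-th entry x_i with x_i'. Writing μ_j(D) = (1/N)·Σ_{n=1}^N x_n^j for the j-th empirical moment, the Euclidean (ℓ₂) norm of the vector (μ_1(D)−μ_1(D'), μ_2(D)−μ_2(D'), …, μ_{K+1}(D)−μ_{K+1}(D')) is at most √((5K+5)/(2N²)). -/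
open Finset

/-- The `j`-th empirical moment of a dataset of `N` reals. -/
noncomputable def empMoment {N : ℕ} (x : Fin N → ℝ) (j : ℕ) : ℝ :=
  (1 / (N : ℝ)) * ∑ n, x n ^ j

lemma pair_sum_bound (a b : ℝ) (ha : a ∈ Set.Icc (-1 : ℝ) 1) (hb : b ∈ Set.Icc (-1 : ℝ) 1)
    (m : ℕ) : ∑ j ∈ Finset.range (2 * m), (a ^ (j + 1) - b ^ (j + 1)) ^ 2 ≤ 5 * (m : ℝ) := by
  have key : ∀ c : ℝ, c ∈ Set.Icc (-1 : ℝ) 1 → ∀ k : ℕ, -1 ≤ c ^ k ∧ c ^ k ≤ 1 := by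
    intro c hc k
    have h : |c ^ k| ≤ 1 := by
      rw [abs_pow]
      exact pow_le_one₀ (abs_nonneg c) (abs_le.mpr hc)
    exact abs_le.mp h
  induction m with
  | zero => simp
  | succ m ih =>
    rw [show 2 * (m + 1) = 2 * m + 1 + 1 by ring, Finset.sum_range_succ, Finset.sum_range_succ]
    obtain ⟨h1, h2⟩ := key a ha (2 * m + 1)
    obtain ⟨h3, h4⟩ := key b hb (2 * m + 1)
    have h5 := (key a ha (2 * m + 1 + 1)).2
    have h6 := (key b hb (2 * m + 1 + 1)).2
    have h7 : 0 ≤ a ^ (2 * m + 1 + 1) := Even.pow_nonneg ⟨m + 1, by ring⟩ a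
    have h8 : 0 ≤ b ^ (2 * m + 1 + 1) := Even.pow_nonneg ⟨m + 1, by ring⟩ b
    have e1 : (a ^ (2 * m + 1) - b ^ (2 * m + 1)) ^ 2 ≤ 4 := by nlinarith
    have e2 : (a ^ (2 * m + 1 + 1) - b ^ (2 * m + 1 + 1)) ^ 2 ≤ 1 := by nlinarith
    push_cast
    linarith

lemma empMoment_diff {N : ℕ} (x : Fin N → ℝ) (i : Fin N) (x' : ℝ) (j : ℕ) :
    empMoment x j - empMoment (Function.update x i x') j
      = (1 / (N : ℝ)) * (x i ^ j - x' ^ j) := by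
  unfold empMoment
  rw [← mul_sub, ← Finset.sum_sub_distrib, Finset.sum_eq_single i]
  · simp
  · intro n _ hn
    simp [Function.update_of_ne hn]
  · simp

/-- Sensitivity of the first `K+1` empirical moments for odd `K`:
replacing one entry of the dataset changes the vector of moments
`(μ_1, …, μ_{K+1})` by at most `√((5K+5)/(2N²))` in `ℓ₂` norm. -/
theorem moment_sensitivity_odd
    (N K : ℕ) (hN : 1 ≤ N) (hK : Odd K)
    (x : Fin N → ℝ) (hx : ∀ n, x n ∈ Set.Icc (-1 : ℝ) 1)
    (i : Fin N) (x' : ℝ) (hx' : x' ∈ Set.Icc (-1 : ℝ) 1) :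
    Real.sqrt (∑ j ∈ Finset.range (K + 1),
        (empMoment x (j + 1) - empMoment (Function.update x i x') (j + 1)) ^ 2)
      ≤ Real.sqrt ((5 * (K : ℝ) + 5) / (2 * (N : ℝ) ^ 2)) := by
  apply Real.sqrt_le_sqrt
  obtain ⟨m, rfl⟩ := hK
  have h := pair_sum_bound (x i) x' (hx i) hx' (m + 1)
  have hN' : (0 : ℝ) < N := by exact_mod_cast hN
  simp only [empMoment_diff, mul_pow, ← Finset.mul_sum]
  rw [show 2 * m + 1 + 1 = 2 * (m + 1) by ring]
  calc _ ≤ (1 / (N : ℝ)) ^ 2 * (5 * ((m + 1 : ℕ) : ℝ)) :=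
        mul_le_mul_of_nonneg_left h (by positivity)
    _ = _ := by
        push_cast
        field_simp
        ring
end

section
/- Let N ≥ 1, let x_1,…,x_N ∈ [−1,1] with empirical CDF F and empirical moments μ_j, and let K be a natural number. Define F̂(x) = Σ_{k=0}^K α_k·(Σ_{i=0}^k β_{k,i}·(1 − μ_{i+1}))·e_k(x), where α_k = 2^k·√((2k+1)/2) and β_{k,i} = (1/(i+1))·C(k,i)·C((k+i−1)/2, k). Then the residual F − F̂ is L²-orthogonal on [−1,1] to every polynomial of degree at most K: for every real polynomial g of degree at most K, ∫_{−1}^1 (F(x) − F̂(x))·g(x) dx = 0. -/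
open Finset

/-- Generalized binomial coefficient `C(a,k) = a(a-1)⋯(a-k+1)/k!`. -/
noncomputable def genChoose (a : ℝ) (k : ℕ) : ℝ :=
  (∏ j ∈ Finset.range k, (a - (j : ℝ))) / (Nat.factorial k : ℝ)

/-- The `k`-th Legendre polynomial in explicit form:
`P_k(x) = 2^k ∑_{i=0}^k C(k,i) C((k+i-1)/2, k) x^i`. -/
noncomputable def legendreP (k : ℕ) (x : ℝ) : ℝ :=
  2 ^ k * ∑ i ∈ Finset.range (k + 1),
    (Nat.choose k i : ℝ) * genChoose (((k : ℝ) + (i : ℝ) - 1) / 2) k * x ^ i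

/-- The `k`-th orthonormal Legendre basis function `e_k(x) = √((2k+1)/2) P_k(x)`. -/
noncomputable def legendreE (k : ℕ) (x : ℝ) : ℝ :=
  Real.sqrt ((2 * (k : ℝ) + 1) / 2) * legendreP k x

/-- `α_k = 2^k √((2k+1)/2)`. -/
noncomputable def coefA (k : ℕ) : ℝ := 2 ^ k * Real.sqrt ((2 * (k : ℝ) + 1) / 2)

/-- `β_{k,i} = (1/(i+1)) C(k,i) C((k+i-1)/2, k)`. -/
noncomputable def coefB (k i : ℕ) : ℝ :=
  (1 / ((i : ℝ) + 1)) * (Nat.choose k i : ℝ) * genChoose (((k : ℝ) + (i : ℝ) - 1) / 2) k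

/-- The empirical cumulative distribution function of a dataset of `N` reals. -/
noncomputable def eCDF {N : ℕ} (x : Fin N → ℝ) (t : ℝ) : ℝ :=
  (1 / (N : ℝ)) * ∑ n, (if x n ≤ t then (1 : ℝ) else 0)

/-- The optimal polynomial approximation `F̂` of the empirical CDF:
`F̂(x) = ∑_{k=0}^K α_k (∑_{i=0}^k β_{k,i} (1 - μ_{i+1})) e_k(x)`. -/
noncomputable def Fhat {N : ℕ} (x : Fin N → ℝ) (K : ℕ) (t : ℝ) : ℝ :=
  ∑ k ∈ Finset.range (K + 1),
    coefA k * (∑ i ∈ Finset.range (k + 1), coefB k i * (1 - empMoment x (i + 1))) *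
      legendreE k t

lemma alt_sum_eq_fwdDiff (f : ℝ → ℝ) (k : ℕ) (y : ℝ) :
    ∑ i ∈ Finset.range (k + 1), (-1 : ℝ) ^ i * (Nat.choose k i : ℝ) * f (y + i)
      = (-1) ^ k * (fwdDiff (1 : ℝ))^[k] f y := by
  rw [fwdDiff_iter_eq_sum_shift, Finset.mul_sum]
  refine Finset.sum_congr rfl fun i hi => ?_
  have hik : i ≤ k := by simpa [Nat.lt_succ_iff] using hi
  obtain ⟨j, rfl⟩ := Nat.exists_eq_add_of_le hik
  have h1 : (-1 : ℝ) ^ j * (-1) ^ j = 1 := by rw [← mul_pow]; simp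
  simp only [zsmul_eq_mul, nsmul_eq_mul, mul_one, add_tsub_cancel_left]
  push_cast
  rw [pow_add]
  linear_combination (-(-1 : ℝ) ^ i * (Nat.choose (i + j) i : ℝ) * f (y + i)) * h1

lemma fwdDiff_iter_inv (k : ℕ) : ∀ y : ℝ, 0 < y →
    (fwdDiff (1 : ℝ))^[k] (fun x : ℝ => 1 / x) y
      = (-1) ^ k * (Nat.factorial k : ℝ) / ∏ j ∈ Finset.range (k + 1), (y + (j : ℝ)) := by
  induction k with
  | zero => intro y hy; simp
  | succ k ih =>
    intro y hy
    rw [Function.iterate_succ_apply', fwdDiff, ih y hy, ih (y + 1) (by linarith)]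
    have e1 : ∏ j ∈ Finset.range (k + 1 + 1), (y + (j : ℝ))
        = (∏ j ∈ Finset.range (k + 1), (y + 1 + (j : ℝ))) * y := by
      rw [Finset.prod_range_succ']
      simp only [Nat.cast_zero, add_zero]
      congr 1
      refine Finset.prod_congr rfl fun j _ => ?_
      push_cast; ring
    have e2 : ∏ j ∈ Finset.range (k + 1 + 1), (y + (j : ℝ))
        = (∏ j ∈ Finset.range (k + 1), (y + (j : ℝ))) * (y + (k + 1)) := by
      rw [Finset.prod_range_succ]; push_cast; ring
    have p1 : 0 < ∏ j ∈ Finset.range (k + 1), (y + (j : ℝ)) :=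
      Finset.prod_pos fun j _ => by positivity
    have p2 : 0 < ∏ j ∈ Finset.range (k + 1), (y + 1 + (j : ℝ)) :=
      Finset.prod_pos fun j _ => by positivity
    have p3 : 0 < ∏ j ∈ Finset.range (k + 1 + 1), (y + (j : ℝ)) :=
      Finset.prod_pos fun j _ => by positivity
    rw [e1] at e2
    rw [e1, Nat.factorial_succ]
    generalize ∏ j ∈ Finset.range (k + 1), (y + (j : ℝ)) = A at *
    generalize ∏ j ∈ Finset.range (k + 1), (y + 1 + (j : ℝ)) = B at *
    have hyk : (0:ℝ) < y + (k + 1) := by positivity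
    have hB : B = A * (y + (k + 1)) / y := by field_simp; exact e2
    subst hB
    push_cast
    field_simp
    ring

/-- alternating sum of a polynomial over a linear form -/
lemma alt_sum_div (k : ℕ) (p : Polynomial ℝ) (hp : p.natDegree ≤ k) (a : ℝ) (ha : 0 < a) :
    ∑ i ∈ Finset.range (k + 1), (-1 : ℝ) ^ i * (Nat.choose k i : ℝ) * (p.eval (i : ℝ) / (a + i))
      = p.eval (-a) * ((Nat.factorial k : ℝ) / ∏ j ∈ Finset.range (k + 1), (a + (j : ℝ))) := by
  set q := (p - Polynomial.C (p.eval (-a))) /ₘ (Polynomial.X - Polynomial.C (-a)) with hq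
  have hroot : (Polynomial.X - Polynomial.C (-a)) * q = p - Polynomial.C (p.eval (-a)) := by
    rw [hq, Polynomial.mul_divByMonic_eq_iff_isRoot]; simp
  have hqsum : ∑ i ∈ Finset.range (k + 1), (-1 : ℝ) ^ i * (Nat.choose k i : ℝ) * q.eval (0 + (i : ℝ))
      = 0 := by
    rcases Nat.eq_zero_or_pos k with h0 | h0
    · have : q = 0 := by
        rw [hq, Polynomial.eq_C_of_natDegree_eq_zero (show p.natDegree = 0 by omega)]; simp
      simp [this]
    · rw [alt_sum_eq_fwdDiff (fun x => q.eval x), Polynomial.fwdDiff_iter_eq_zero_of_degree_lt]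
      · simp
      · rw [hq, Polynomial.natDegree_divByMonic _ (Polynomial.monic_X_sub_C _)]
        rw [Polynomial.natDegree_X_sub_C, Polynomial.natDegree_sub_C]
        omega
  have hinv := alt_sum_eq_fwdDiff (fun x : ℝ => 1 / x) k a
  rw [fwdDiff_iter_inv k a ha] at hinv
  have h1 : (-1 : ℝ) ^ k * (-1) ^ k = 1 := by rw [← mul_pow]; simp
  rw [mul_div_assoc, ← mul_assoc, h1, one_mul] at hinv
  rw [← hinv, Finset.mul_sum, ← sub_eq_zero, ← Finset.sum_sub_distrib, ← hqsum]
  refine Finset.sum_congr rfl fun i _ => ?_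
  have hne : a + (i : ℝ) ≠ 0 := by positivity
  have := congrArg (Polynomial.eval (i : ℝ)) hroot
  simp at this
  have hp' : p.eval (i : ℝ) = (i + a) * q.eval (i : ℝ) + p.eval (-a) := by linarith
  rw [hp', zero_add]
  field_simp
  ring

noncomputable def legC (k i : ℕ) : ℝ :=
  2 ^ k * ((Nat.choose k i : ℝ) * genChoose (((k : ℝ) + (i : ℝ) - 1) / 2) k)

lemma legendreP_eq (k : ℕ) (t : ℝ) :
    legendreP k t = ∑ i ∈ Finset.range (k + 1), legC k i * t ^ i := by
  rw [legendreP, Finset.mul_sum]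
  exact Finset.sum_congr rfl fun i _ => by rw [legC]; ring

lemma legC_odd {k i : ℕ} (hi : i ≤ k) (h : Odd (k + i)) : legC k i = 0 := by
  obtain ⟨r, hr⟩ := h
  have : genChoose (((k : ℝ) + (i : ℝ) - 1) / 2) k = 0 := by
    rw [genChoose, Finset.prod_eq_zero (i := r), zero_div]
    · simp; omega
    · have : (k : ℝ) + i = 2 * r + 1 := by exact_mod_cast hr
      rw [this]; ring
  rw [legC, this]; ring

noncomputable def legPoly (k : ℕ) : Polynomial ℝ :=
  ∏ l ∈ Finset.range k,
    (Polynomial.C (1 / 2 : ℝ) * Polynomial.X + Polynomial.C (((k : ℝ) - 1) / 2 - (l : ℝ)))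

lemma legPoly_deg (k : ℕ) : (legPoly k).natDegree ≤ k := by
  refine (Polynomial.natDegree_prod_le _ _).trans ?_
  refine (Finset.sum_le_sum (g := fun _ => 1) fun i _ => Polynomial.natDegree_linear_le).trans ?_
  simp

lemma legPoly_eval (k : ℕ) (y : ℝ) :
    (legPoly k).eval y = ∏ l ∈ Finset.range k, ((y + k - 1) / 2 - (l : ℝ)) := by
  rw [legPoly, Polynomial.eval_prod]
  refine Finset.prod_congr rfl fun l _ => ?_
  simp; ring

lemma legC_eq (k i : ℕ) :
    legC k i = 2 ^ k / (Nat.factorial k : ℝ) * ((Nat.choose k i : ℝ) * (legPoly k).eval (i : ℝ)) := by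
  rw [legC, legPoly_eval, genChoose, add_comm (k : ℝ)]; ring

lemma int_pow_legendreP (k m : ℕ) :
    ∫ t in (-1 : ℝ)..1, t ^ m * legendreP k t
      = ∑ i ∈ Finset.range (k + 1), legC k i * ((1 - (-1) ^ (m + i + 1)) / ((m : ℝ) + i + 1)) := by
  simp_rw [legendreP_eq, Finset.mul_sum]
  rw [intervalIntegral.integral_finsetSum]
  · refine Finset.sum_congr rfl fun i _ => ?_
    have : ∀ t : ℝ, t ^ m * (legC k i * t ^ i) = legC k i * t ^ (m + i) := fun t => by ring
    simp_rw [this]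
    rw [intervalIntegral.integral_const_mul, integral_pow]
    push_cast
    simp
  · intro i _
    exact (by fun_prop : Continuous fun t : ℝ => t ^ m * (legC k i * t ^ i)).intervalIntegrable _ _

lemma int_pow_legendreP_even (k m : ℕ) (h : Even (m + k)) :
    ∫ t in (-1 : ℝ)..1, t ^ m * legendreP k t
      = 2 ^ (k + 1) * (-1) ^ k * (legPoly k).eval (-((m : ℝ) + 1))
        / ∏ j ∈ Finset.range (k + 1), ((m : ℝ) + 1 + (j : ℝ)) := by
  rw [int_pow_legendreP]
  have key := alt_sum_div k (legPoly k) (legPoly_deg k) ((m : ℝ) + 1) (by positivity)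
  have hk : (Nat.factorial k : ℝ) ≠ 0 := by positivity
  have : ∀ i ∈ Finset.range (k + 1),
      legC k i * ((1 - (-1) ^ (m + i + 1)) / ((m : ℝ) + i + 1))
      = 2 ^ (k + 1) * (-1) ^ k / (Nat.factorial k : ℝ) *
        ((-1 : ℝ) ^ i * (Nat.choose k i : ℝ) * ((legPoly k).eval (i : ℝ) / ((m : ℝ) + 1 + i))) := by
    intro i hi
    have hik : i ≤ k := by simpa [Nat.lt_succ_iff] using hi
    rcases Nat.even_or_odd (k + i) with he | ho
    · have e1 : (-1 : ℝ) ^ (m + i + 1) = -1 := by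
        apply Odd.neg_one_pow; grind
      have e2 : (-1 : ℝ) ^ k * (-1) ^ i = 1 := by
        rw [← pow_add]; exact he.neg_one_pow
      have e3 : (m : ℝ) + 1 + i = m + i + 1 := by ring
      rw [e1, legC_eq, e3, pow_succ]
      linear_combination (-(2 ^ k * 2 / (Nat.factorial k : ℝ)) * (Nat.choose k i : ℝ) *
        ((legPoly k).eval (i : ℝ) / ((m : ℝ) + i + 1))) * e2
    · have h0 := legC_odd hik ho
      have h1 := h0
      rw [legC_eq] at h1
      have h2 : (Nat.choose k i : ℝ) * (legPoly k).eval (i : ℝ) = 0 := by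
        rcases mul_eq_zero.1 h1 with h | h
        · exfalso; revert h; positivity
        · exact h
      rw [h0, zero_mul]
      linear_combination (-(2 ^ (k + 1) * (-1) ^ k / (Nat.factorial k : ℝ)) * (-1 : ℝ) ^ i
        / ((m : ℝ) + 1 + i)) * h2
  rw [Finset.sum_congr rfl this, ← Finset.mul_sum, key]
  field_simp

lemma int_pow_lt (k m : ℕ) (h : m < k) : ∫ t in (-1 : ℝ)..1, t ^ m * legendreP k t = 0 := by
  rcases Nat.even_or_odd (m + k) with he | ho
  · rw [int_pow_legendreP_even k m he, legPoly_eval]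
    obtain ⟨r, hr⟩ := he
    rw [Finset.prod_eq_zero (i := r - m - 1)]
    · simp
    · simp; omega
    · have h1 : ((r - m - 1 : ℕ) : ℝ) = r - m - 1 := by
        rw [Nat.sub_sub, Nat.cast_sub (by omega)]; push_cast; ring
      have : (m : ℝ) + k = r + r := by exact_mod_cast hr
      rw [h1]; linarith
  · rw [int_pow_legendreP]
    refine Finset.sum_eq_zero fun i hi => ?_
    have hik : i ≤ k := by simpa [Nat.lt_succ_iff] using hi
    rcases Nat.even_or_odd (k + i) with he | ho'
    · rw [Even.neg_one_pow (by grind)]; simp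
    · rw [legC_odd hik ho']; simp

lemma int_pow_self (k : ℕ) : ∫ t in (-1 : ℝ)..1, t ^ k * legendreP k t
    = 2 ^ (k + 1) * (Nat.factorial k : ℝ) / ∏ j ∈ Finset.range (k + 1), ((k : ℝ) + 1 + (j : ℝ)) := by
  rw [int_pow_legendreP_even k k ⟨k, rfl⟩, legPoly_eval]
  have : ∏ l ∈ Finset.range k, ((-((k : ℝ) + 1) + k - 1) / 2 - (l : ℝ))
      = (-1) ^ k * (Nat.factorial k : ℝ) := by
    rw [← Finset.prod_range_add_one_eq_factorial]
    push_cast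
    rw [← Finset.card_range k, ← Finset.prod_const, Finset.card_range, ← Finset.prod_mul_distrib]
    exact Finset.prod_congr rfl fun l _ => by ring
  rw [this]
  have h1 : (-1 : ℝ) ^ k * (-1) ^ k = 1 := by rw [← mul_pow]; simp
  congr 1
  linear_combination (2 ^ (k + 1) * (Nat.factorial k : ℝ)) * h1

lemma legC_self (k : ℕ) : legC k k * (Nat.factorial k : ℝ) = ∏ l ∈ Finset.range k, (2 * (l : ℝ) + 1) := by
  have hk : (Nat.factorial k : ℝ) ≠ 0 := by positivity
  rw [legC, genChoose, Nat.choose_self, ← Finset.prod_range_reflect]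
  rw [show (2:ℝ) ^ k = ∏ l ∈ Finset.range k, 2 by simp]
  field_simp
  rw [Nat.cast_one, mul_one, ← Finset.prod_mul_distrib]
  refine Finset.prod_congr rfl fun l hl => ?_
  have : l + 1 ≤ k := by simpa using hl
  rw [Nat.sub_sub, Nat.cast_sub (by omega)]
  push_cast; ring

lemma prod_aux (k : ℕ) : ∏ j ∈ Finset.range (k + 1), ((k : ℝ) + 1 + (j : ℝ))
    = 2 ^ k * (2 * k + 1) * ∏ l ∈ Finset.range k, (2 * (l : ℝ) + 1) := by
  induction k with
  | zero => simp
  | succ k ih =>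
    rw [Finset.prod_range_succ (fun l : ℕ => 2 * (l : ℝ) + 1)]
    have h := Finset.prod_range_succ' (fun j : ℕ => (k : ℝ) + 1 + (j : ℝ)) (k + 2)
    rw [Finset.prod_range_succ, Finset.prod_range_succ, ih] at h
    have e : ∏ j ∈ Finset.range (k + 1 + 1), (((k + 1 : ℕ) : ℝ) + 1 + (j : ℝ))
        = ∏ j ∈ Finset.range (k + 2), ((k : ℝ) + 1 + ((j + 1 : ℕ) : ℝ)) :=
      Finset.prod_congr rfl fun j _ => by push_cast; ring
    rw [e]
    have hk : (k : ℝ) + 1 ≠ 0 := by positivity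
    apply mul_right_cancel₀ hk
    push_cast at h ⊢
    simp only [add_zero] at h
    rw [← h]; ring

lemma legendreP_continuous (k : ℕ) : Continuous (legendreP k) := by
  have : legendreP k = fun t => ∑ i ∈ Finset.range (k + 1), legC k i * t ^ i :=
    funext (legendreP_eq k)
  rw [this]; fun_prop

lemma int_mul_sum (f : ℝ → ℝ) (hf : IntervalIntegrable f MeasureTheory.volume (-1) 1)
    (n : ℕ) (c : ℕ → ℝ) :
    ∫ t in (-1 : ℝ)..1, f t * ∑ i ∈ Finset.range n, c i * t ^ i
      = ∑ i ∈ Finset.range n, c i * ∫ t in (-1 : ℝ)..1, f t * t ^ i := by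
  simp_rw [Finset.mul_sum]
  rw [intervalIntegral.integral_finsetSum]
  · refine Finset.sum_congr rfl fun i _ => ?_
    rw [← intervalIntegral.integral_const_mul]
    congr 1; ext t; ring
  · intro i _
    exact hf.mul_continuousOn (by fun_prop)

lemma int_legendreP_lt {k m : ℕ} (h : m < k) :
    ∫ t in (-1 : ℝ)..1, legendreP k t * legendreP m t = 0 := by
  simp_rw [legendreP_eq m]
  rw [int_mul_sum _ ((legendreP_continuous k).intervalIntegrable _ _)]
  refine Finset.sum_eq_zero fun i hi => ?_
  have : i < k := by simp at hi; omega
  simp_rw [mul_comm (legendreP k _)]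
  rw [int_pow_lt k i this, mul_zero]

lemma int_legendreP_ne {k m : ℕ} (h : k ≠ m) :
    ∫ t in (-1 : ℝ)..1, legendreP k t * legendreP m t = 0 := by
  rcases lt_or_gt_of_ne h with h | h
  · simp_rw [mul_comm (legendreP k _)]
    exact int_legendreP_lt h
  · exact int_legendreP_lt h

lemma int_legendreP_self (k : ℕ) :
    ∫ t in (-1 : ℝ)..1, legendreP k t * legendreP k t = 2 / (2 * k + 1) := by
  have e : ∀ t, legendreP k t * legendreP k t
    = legendreP k t * ∑ i ∈ Finset.range (k + 1), legC k i * t ^ i := fun t => by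
      rw [← legendreP_eq]
  simp_rw [e]
  rw [int_mul_sum _ ((legendreP_continuous k).intervalIntegrable _ _), Finset.sum_range_succ,
    Finset.sum_eq_zero, zero_add]
  · simp_rw [mul_comm (legendreP k _)]
    rw [int_pow_self, prod_aux, ← legC_self]
    have h1 := legC_self k
    have h2 : 0 < ∏ l ∈ Finset.range k, (2 * (l : ℝ) + 1) :=
      Finset.prod_pos fun j _ => by positivity
    have h3 : legC k k ≠ 0 := by
      intro h; rw [h, zero_mul] at h1; exact h2.ne h1
    field_simp
    ring
  · intro i hi
    simp_rw [mul_comm (legendreP k _)]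
    rw [int_pow_lt k i (by simpa using hi), mul_zero]

lemma step_integrable (a : ℝ) :
    IntervalIntegrable (fun t : ℝ => if a ≤ t then (1 : ℝ) else 0) MeasureTheory.volume (-1) 1 := by
  apply Monotone.intervalIntegrable
  intro s t hst
  dsimp only
  split_ifs <;> linarith

lemma step_int (a : ℝ) (ha : a ∈ Set.Icc (-1 : ℝ) 1) (i : ℕ) :
    ∫ t in (-1 : ℝ)..1, (if a ≤ t then (1 : ℝ) else 0) * t ^ i = (1 - a ^ (i + 1)) / (i + 1) := by
  have hint : ∀ u v : ℝ, u ∈ Set.Icc (-1 : ℝ) 1 → v ∈ Set.Icc (-1 : ℝ) 1 → IntervalIntegrable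
      (fun t : ℝ => (if a ≤ t then (1 : ℝ) else 0) * t ^ i) MeasureTheory.volume u v := by
    intro u v hu hv
    refine ((step_integrable a).mul_continuousOn (by fun_prop)).mono_set ?_
    rw [Set.uIcc_of_le (by norm_num : (-1 : ℝ) ≤ 1)]
    exact Set.uIcc_subset_Icc hu hv
  rw [← intervalIntegral.integral_add_adjacent_intervals (b := a)
    (hint _ _ (by simp) ha) (hint _ _ ha (by simp))]
  have h1 : ∫ t in (-1 : ℝ)..a, (if a ≤ t then (1 : ℝ) else 0) * t ^ i = 0 := by
    rw [intervalIntegral.integral_of_le ha.1, MeasureTheory.integral_Ioc_eq_integral_Ioo]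
    rw [MeasureTheory.setIntegral_congr_fun (g := fun _ => (0 : ℝ)) measurableSet_Ioo]
    · simp
    · intro t ht
      simp [not_le.2 ht.2]
  have h2 : ∫ t in a..1, (if a ≤ t then (1 : ℝ) else 0) * t ^ i = ∫ t in a..1, t ^ i := by
    apply intervalIntegral.integral_congr
    intro t ht
    rw [Set.uIcc_of_le ha.2] at ht
    simp [ht.1]
  rw [h1, h2, integral_pow]; simp

lemma eCDF_integrable {N : ℕ} (x : Fin N → ℝ) :
    IntervalIntegrable (eCDF x) MeasureTheory.volume (-1) 1 := by
  unfold eCDF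
  apply IntervalIntegrable.const_mul
  have := IntervalIntegrable.sum (μ := MeasureTheory.volume) (a := (-1 : ℝ)) (b := 1) Finset.univ
    (f := fun n : Fin N => fun t : ℝ => if x n ≤ t then (1 : ℝ) else 0)
    (fun n _ => step_integrable (x n))
  have e : (fun t : ℝ => ∑ n : Fin N, if x n ≤ t then (1 : ℝ) else 0)
      = ∑ n : Fin N, fun t : ℝ => if x n ≤ t then (1 : ℝ) else 0 := by
    ext t; simp
  rw [e]
  exact this

lemma eCDF_int_pow {N : ℕ} (hN : 1 ≤ N) (x : Fin N → ℝ) (hx : ∀ n, x n ∈ Set.Icc (-1 : ℝ) 1)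
    (i : ℕ) : ∫ t in (-1 : ℝ)..1, eCDF x t * t ^ i = (1 - empMoment x (i + 1)) / (i + 1) := by
  simp_rw [eCDF, mul_assoc, Finset.sum_mul]
  rw [intervalIntegral.integral_const_mul, intervalIntegral.integral_finsetSum]
  · simp_rw [step_int _ (hx _)]
    have : (N : ℝ) ≠ 0 := by positivity
    rw [← Finset.sum_div, Finset.sum_sub_distrib, empMoment]
    simp
    field_simp
  · intro n _
    exact (step_integrable (x n)).mul_continuousOn (by fun_prop)

lemma eCDF_int_leg {N : ℕ} (hN : 1 ≤ N) (x : Fin N → ℝ) (hx : ∀ n, x n ∈ Set.Icc (-1 : ℝ) 1)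
    (k : ℕ) : ∫ t in (-1 : ℝ)..1, eCDF x t * legendreP k t
      = 2 ^ k * ∑ i ∈ Finset.range (k + 1), coefB k i * (1 - empMoment x (i + 1)) := by
  simp_rw [legendreP_eq]
  rw [int_mul_sum _ (eCDF_integrable x), Finset.mul_sum]
  refine Finset.sum_congr rfl fun i _ => ?_
  rw [eCDF_int_pow hN x hx, legC, coefB]
  ring

lemma Fhat_continuous {N : ℕ} (x : Fin N → ℝ) (K : ℕ) : Continuous (Fhat x K) := by
  unfold Fhat legendreE
  have := legendreP_continuous
  fun_prop

lemma Fhat_int_leg {N : ℕ} (x : Fin N → ℝ) (K m : ℕ) (hm : m ≤ K) :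
    ∫ t in (-1 : ℝ)..1, Fhat x K t * legendreP m t
      = 2 ^ m * ∑ i ∈ Finset.range (m + 1), coefB m i * (1 - empMoment x (i + 1)) := by
  have hc := legendreP_continuous
  simp_rw [Fhat, legendreE, Finset.sum_mul]
  rw [intervalIntegral.integral_finsetSum]
  · simp_rw [mul_assoc]
    simp only [intervalIntegral.integral_const_mul]
    rw [Finset.sum_eq_single m]
    · rw [int_legendreP_self, coefA]
      have hs : Real.sqrt ((2 * (m : ℝ) + 1) / 2) * Real.sqrt ((2 * (m : ℝ) + 1) / 2)
        = (2 * (m : ℝ) + 1) / 2 := Real.mul_self_sqrt (by positivity)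
      generalize Real.sqrt ((2 * (m : ℝ) + 1) / 2) = s at *
      generalize ∑ i ∈ Finset.range (m + 1), coefB m i * (1 - empMoment x (i + 1)) = S
      have : 2 ^ m * s * (S * (s * (2 / (2 * (m : ℝ) + 1))))
        = 2 ^ m * S * (s * s) * (2 / (2 * (m : ℝ) + 1)) := by ring
      rw [this, hs]
      field_simp
    · intro k _ hk
      rw [int_legendreP_ne hk]; simp
    · intro h; simp at h; omega
  · intro k _
    exact (by fun_prop : Continuous _).intervalIntegrable _ _

/-- The residual `F - F̂` is `L²`-orthogonal on `[-1,1]` to every polynomial of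
degree at most `K`. -/
theorem Fhat_residual_orthogonal
    (N : ℕ) (hN : 1 ≤ N)
    (x : Fin N → ℝ) (hx : ∀ n, x n ∈ Set.Icc (-1 : ℝ) 1)
    (K : ℕ) (g : Polynomial ℝ) (hg : g.natDegree ≤ K) :
    ∫ t in (-1 : ℝ)..1, (eCDF x t - Fhat x K t) * g.eval t = 0 := by
  have hR : IntervalIntegrable (fun t => eCDF x t - Fhat x K t) MeasureTheory.volume (-1) 1 :=
    (eCDF_integrable x).sub ((Fhat_continuous x K).intervalIntegrable _ _)
  have hleg : ∀ m ≤ K, ∫ t in (-1 : ℝ)..1, (eCDF x t - Fhat x K t) * legendreP m t = 0 := by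
    intro m hm
    simp_rw [sub_mul]
    rw [intervalIntegral.integral_sub, eCDF_int_leg hN x hx, Fhat_int_leg x K m hm, sub_self]
    · exact (eCDF_integrable x).mul_continuousOn (legendreP_continuous m).continuousOn
    · exact ((Fhat_continuous x K).mul (legendreP_continuous m)).intervalIntegrable _ _
  have hpow : ∀ m ≤ K, ∫ t in (-1 : ℝ)..1, (eCDF x t - Fhat x K t) * t ^ m = 0 := by
    intro m
    induction m using Nat.strong_induction_on with
    | _ m ih =>
      intro hm
      have h := hleg m hm
      simp_rw [legendreP_eq] at h
      rw [int_mul_sum _ hR, Finset.sum_range_succ, Finset.sum_eq_zero, zero_add] at h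
      · have h1 := legC_self m
        have h2 : 0 < ∏ l ∈ Finset.range m, (2 * (l : ℝ) + 1) :=
          Finset.prod_pos fun j _ => by positivity
        rcases mul_eq_zero.1 h with h | h
        · rw [h, zero_mul] at h1; exact absurd h1 h2.ne
        · exact h
      · intro i hi
        have hi' : i < m := by simpa using hi
        rw [ih i hi' (by omega), mul_zero]
  simp_rw [Polynomial.eval_eq_sum_range]
  rw [int_mul_sum _ hR]
  refine Finset.sum_eq_zero fun i hi => ?_
  rw [hpow i (by simp at hi; omega), mul_zero]
end
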